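/- (Instability of self-shrinking cylinders, Lemma 4.1.) Let n > k ≥ 1 be integers and R > 0 a real, and set m = n − k. Then there exist reals r > 0 and c > 0 such that the function u(t) = ∏_{i=1}^m cos(π t_i / r) on ℝ^m satisfies: (i) u(t) > 0 for every t in the open cube Q_r = (−r/2, r/2)^m; (ii) u(t) = 0 whenever |t_i| = r/2 for some i (so u, restricted to the closed cube, vanishes on its boundary); and (iii) Δu(t) − (1/2)⟨t, ∇u(t)⟩ + (1/2 + k/R²) u(t) ≥ c · u(t) for every t ∈ Q_r. -/

import Mathlib

open Real Finset

/-- The `i`-th partial derivative of a function `f : ℝ^m → ℝ` at `t`. -/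
noncomputable def pderiv' {m : ℕ} (f : (Fin m → ℝ) → ℝ) (i : Fin m) (t : Fin m → ℝ) : ℝ :=
  deriv (fun s : ℝ => f (Function.update t i s)) (t i)

/-- The Euclidean Laplacian of `f : ℝ^m → ℝ` at `t`: the sum of the second partial
derivatives `∑ i, ∂²f/∂t_i²`. -/
noncomputable def laplacian' {m : ℕ} (f : (Fin m → ℝ) → ℝ) (t : Fin m → ℝ) : ℝ :=
  ∑ i, pderiv' (pderiv' f i) i t

/-- The function `u(t) = ∏_{i=1}^m cos(π t_i / r)` on `ℝ^m`. -/
noncomputable def uFun (m : ℕ) (r : ℝ) (t : Fin m → ℝ) : ℝ :=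
  ∏ i, Real.cos (π * t i / r)

/-- The product of the factors of `uFun m r t` other than the `i`-th one. -/
noncomputable def uFunErase (m : ℕ) (r : ℝ) (i : Fin m) (t : Fin m → ℝ) : ℝ :=
  ∏ j ∈ univ.erase i, Real.cos (π * t j / r)

lemma uFun_eq_cos_mul_uFunErase {m : ℕ} (r : ℝ) (i : Fin m) (t : Fin m → ℝ) :
    uFun m r t = Real.cos (π * t i / r) * uFunErase m r i t :=
  (Finset.mul_prod_erase univ (fun j => Real.cos (π * t j / r)) (mem_univ i)).symm

lemma uFunErase_update {m : ℕ} (r : ℝ) (i : Fin m) (t : Fin m → ℝ) (s : ℝ) :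
    uFunErase m r i (Function.update t i s) = uFunErase m r i t :=
  Finset.prod_congr rfl fun j hj => by
    rw [Function.update_of_ne (Finset.ne_of_mem_erase hj)]

lemma pderiv'_uFun {m : ℕ} (r : ℝ) (i : Fin m) (t : Fin m → ℝ) :
    pderiv' (uFun m r) i t = -Real.sin (π * t i / r) * (π / r) * uFunErase m r i t := by
  have hlin : HasDerivAt (fun s : ℝ => π * s / r) (π / r) (t i) := by
    simpa using ((hasDerivAt_id (t i)).const_mul π).div_const r
  simp only [pderiv', uFun_eq_cos_mul_uFunErase r i, uFunErase_update, Function.update_self]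
  exact (hlin.cos.mul_const _).deriv

lemma pderiv'_pderiv'_uFun {m : ℕ} (r : ℝ) (i : Fin m) (t : Fin m → ℝ) :
    pderiv' (pderiv' (uFun m r) i) i t = -(π / r) ^ 2 * uFun m r t := by
  have hlin : HasDerivAt (fun s : ℝ => π * s / r) (π / r) (t i) := by
    simpa using ((hasDerivAt_id (t i)).const_mul π).div_const r
  rw [pderiv', uFun_eq_cos_mul_uFunErase r i]
  simp only [pderiv'_uFun, uFunErase_update, Function.update_self]
  refine ((hlin.sin.neg.mul_const (π / r)).mul_const (uFunErase m r i t)).deriv.trans ?_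
  ring

/-- `uFun m r` is an eigenfunction of the Laplacian with eigenvalue `-m (π / r) ^ 2`. -/
lemma laplacian'_uFun {m : ℕ} (r : ℝ) (t : Fin m → ℝ) :
    laplacian' (uFun m r) t = -(m * (π / r) ^ 2) * uFun m r t := by
  simp only [laplacian', pderiv'_pderiv'_uFun, sum_const, card_univ, Fintype.card_fin,
    nsmul_eq_mul]
  ring

lemma pi_mul_div_mem_Ioo {r x : ℝ} (hr : 0 < r) (hx : x ∈ Set.Ioo (-(r / 2)) (r / 2)) :
    π * x / r ∈ Set.Ioo (-(π / 2)) (π / 2) := by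
  constructor
  · rw [lt_div_iff₀ hr]
    nlinarith [mul_lt_mul_of_pos_left hx.1 pi_pos]
  · rw [div_lt_iff₀ hr]
    nlinarith [mul_lt_mul_of_pos_left hx.2 pi_pos]

lemma uFun_pos {m : ℕ} {r : ℝ} (hr : 0 < r) {t : Fin m → ℝ}
    (ht : ∀ i, t i ∈ Set.Ioo (-(r / 2)) (r / 2)) : 0 < uFun m r t :=
  Finset.prod_pos fun i _ => Real.cos_pos_of_mem_Ioo (pi_mul_div_mem_Ioo hr (ht i))

lemma uFun_eq_zero {m : ℕ} {r : ℝ} (hr : 0 < r) {t : Fin m → ℝ} {i : Fin m}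
    (hi : |t i| = r / 2) : uFun m r t = 0 := by
  refine Finset.prod_eq_zero (mem_univ i) ?_
  rw [← Real.cos_abs, abs_div, abs_mul, hi, abs_of_pos pi_pos, abs_of_pos hr,
    show π * (r / 2) / r = π / 2 by field_simp, Real.cos_pi_div_two]

lemma mul_sin_nonneg {x : ℝ} (hx : x ∈ Set.Icc (-π) π) : 0 ≤ x * Real.sin x := by
  rcases le_total 0 x with h | h
  · exact mul_nonneg h (Real.sin_nonneg_of_nonneg_of_le_pi h hx.2)
  · exact mul_nonneg_of_nonpos_of_nonpos h (Real.sin_nonpos_of_nonpos_of_neg_pi_le h hx.1)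

/-- On the cube, `uFun m r` decreases away from the origin in each coordinate. -/
lemma mul_pderiv'_uFun_nonpos {m : ℕ} {r : ℝ} (hr : 0 < r) {t : Fin m → ℝ}
    (ht : ∀ i, t i ∈ Set.Ioo (-(r / 2)) (r / 2)) (i : Fin m) :
    t i * pderiv' (uFun m r) i t ≤ 0 := by
  have hmem := pi_mul_div_mem_Ioo hr (ht i)
  have hsin : 0 ≤ π * t i / r * Real.sin (π * t i / r) :=
    mul_sin_nonneg ⟨by linarith [hmem.1, pi_pos], by linarith [hmem.2, pi_pos]⟩
  have herase : 0 ≤ uFunErase m r i t :=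
    Finset.prod_nonneg fun j _ =>
      (Real.cos_pos_of_mem_Ioo (pi_mul_div_mem_Ioo hr (ht j))).le
  calc t i * pderiv' (uFun m r) i t
      = -(π * t i / r * Real.sin (π * t i / r) * uFunErase m r i t) := by
        rw [pderiv'_uFun]; ring
    _ ≤ 0 := neg_nonpos.2 (mul_nonneg hsin herase)

/-- (Instability of self-shrinking cylinders, Lemma 4.1.) Let `n > k ≥ 1` be integers and
`R > 0` a real, and set `m = n − k`. Then there exist reals `r > 0` and `c > 0` such that
the function `u(t) = ∏_{i=1}^m cos(π t_i / r)` on `ℝ^m` satisfies: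
(i) `u(t) > 0` for every `t` in the open cube `Q_r = (−r/2, r/2)^m`;
(ii) `u(t) = 0` whenever `|t_i| = r/2` for some `i`; and
(iii) `Δu(t) − (1/2)⟨t, ∇u(t)⟩ + (1/2 + k/R²) u(t) ≥ c · u(t)` for every `t ∈ Q_r`. -/
theorem cylinder_unstable (n k : ℕ) (hk : 1 ≤ k) (hkn : k < n) (R : ℝ) (hR : 0 < R) :
    ∃ r c : ℝ, 0 < r ∧ 0 < c ∧
      (∀ t : Fin (n - k) → ℝ, (∀ i, t i ∈ Set.Ioo (-(r / 2)) (r / 2)) →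
        0 < uFun (n - k) r t) ∧
      (∀ t : Fin (n - k) → ℝ, (∃ i, |t i| = r / 2) → uFun (n - k) r t = 0) ∧
      (∀ t : Fin (n - k) → ℝ, (∀ i, t i ∈ Set.Ioo (-(r / 2)) (r / 2)) →
        laplacian' (uFun (n - k) r) t - (1 / 2) * (∑ i, t i * pderiv' (uFun (n - k) r) i t)
            + (1 / 2 + (k : ℝ) / R ^ 2) * uFun (n - k) r t
          ≥ c * uFun (n - k) r t) := by
  have hm : (1 : ℝ) ≤ ((n - k : ℕ) : ℝ) := by exact_mod_cast Nat.sub_pos_of_lt hkn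
  have hr : 0 < 2 * π * ((n - k : ℕ) : ℝ) := by positivity
  refine ⟨2 * π * ((n - k : ℕ) : ℝ), 1 / 4, hr, by norm_num, fun t ht => uFun_pos hr ht,
    fun t ⟨i, hi⟩ => uFun_eq_zero hr hi, fun t ht => ?_⟩
  have hsum := Finset.sum_nonpos fun i (_ : i ∈ univ) => mul_pderiv'_uFun_nonpos hr ht i
  have hu := uFun_pos hr ht
  rw [laplacian'_uFun]
  generalize ((n - k : ℕ) : ℝ) = a at *
  have heig : a * (π / (2 * π * a)) ^ 2 ≤ 1 / 4 := by
    have hsimp : a * (π / (2 * π * a)) ^ 2 = 1 / (4 * a) := by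
      field_simp
      norm_num
    rw [hsimp]
    exact one_div_le_one_div_of_le (by norm_num) (by linarith)
  have hpot : 0 ≤ (k : ℝ) / R ^ 2 := by positivity
  nlinarith [mul_le_mul_of_nonneg_right heig hu.le, mul_nonneg hpot hu.le]
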